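/- Let τ be a square-tiled surface, let {i,j} be {R,G} or {G,B}, and let c be an {i,j}-component of τ. Then c is also an {i,j}-component of Shear_{c,i,j}(τ), and Shear_{c,j,i}(Shear_{c,i,j}(τ)) = τ. -/

import Mathlib

/-! Common definitions: square-tiled surfaces as triples of involutions,
cylinder shears, profiles, etc. -/

inductive Color : Type
  | R | G | B
  deriving DecidableEq

/-- A candidate square-tiled surface on `Fin n`: a triple of permutations
indexed by the three colours. -/
abbrev Surf (n : ℕ) := Color → Equiv.Perm (Fin n)

/-- `f` is a square-tiled surface on `{1,…,n}` (`n ≥ 1`): the three permutations are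
involutions and the subgroup they generate acts transitively. -/
def IsSTS (n : ℕ) (f : Surf n) : Prop :=
  1 ≤ n ∧ (∀ X, f X * f X = 1) ∧
    ∀ x y : Fin n,
      ∃ p ∈ Subgroup.closure ({f Color.R, f Color.G, f Color.B} : Set (Equiv.Perm (Fin n))),
        p x = y

/-- Number of fixed points of a permutation of `Fin n`. -/
def fixedCount {n : ℕ} (π : Equiv.Perm (Fin n)) : ℕ :=
  (Finset.univ.filter fun x => π x = x).card

/-- Number of cycles of length `i` of `π`, fixed points counted as cycles of length 1. -/
def cycleCount {n : ℕ} (π : Equiv.Perm (Fin n)) (i : ℕ) : ℕ :=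
  if i = 1 then fixedCount π else Multiset.count i π.cycleType

/-- The product `τ_R · τ_G · τ_B`. -/
def prodRGB {n : ℕ} (f : Surf n) : Equiv.Perm (Fin n) :=
  f Color.R * f Color.G * f Color.B

/-- Total number of fixed points of the three permutations. -/
def totalFixed {n : ℕ} (f : Surf n) : ℕ :=
  fixedCount (f Color.R) + fixedCount (f Color.G) + fixedCount (f Color.B)

/-- `f` has profile `(μ, k)`: `μ i` is the number of cycles of length `i` of
`τ_R·τ_G·τ_B` (for `i ≥ 1`), and `k` is the total number of fixed points of the
three involutions. -/
def HasProfile {n : ℕ} (f : Surf n) (μ : ℕ → ℕ) (k : ℕ) : Prop :=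
  (∀ i, 1 ≤ i → cycleCount (prodRGB f) i = μ i) ∧ totalFixed f = k

open Classical in
/-- The permutation acting as `σ` on the (`σ`-invariant) set `c` and as the identity
outside of `c`. (Junk value `1` if `c` is not `σ`-invariant.) -/
noncomputable def restrictPerm {α : Type*} (σ : Equiv.Perm α) (c : Set α) : Equiv.Perm α :=
  if h : ∀ x, σ x ∈ c ↔ x ∈ c then
    { toFun := fun x => if x ∈ c then σ x else x
      invFun := fun x => if x ∈ c then σ.symm x else x
      left_inv := fun x => by
        by_cases hx : x ∈ c
        · simp [hx, (h x).mpr hx]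
        · simp [hx]
      right_inv := fun x => by
        by_cases hx : x ∈ c
        · have h1 : σ.symm x ∈ c := (h (σ.symm x)).mp (by simpa using hx)
          simp [hx, h1]
        · simp [hx] }
  else 1

/-- `c` is an `{i,j}`-component of `f`: an orbit of the subgroup generated by
`f i` and `f j`. -/
def IsComponent (n : ℕ) (f : Surf n) (i j : Color) (c : Set (Fin n)) : Prop :=
  ∃ x : Fin n,
    c = MulAction.orbit ↥(Subgroup.closure ({f i, f j} : Set (Equiv.Perm (Fin n)))) x

/-- The cylinder shear `Shear_{c,i,j}`: replace `f i` by `f i · c_i · c_j` and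
`f j` by `f j · c_i · c_j`, keeping the third permutation unchanged. -/
noncomputable def shear {n : ℕ} (f : Surf n) (i j : Color) (c : Set (Fin n)) : Surf n :=
  fun X =>
    if X = i ∨ X = j then f X * restrictPerm (f i) c * restrictPerm (f j) c else f X

/-- `m`-th power of the cylinder shear `Shear_{c,i,j}`. -/
noncomputable def shearPow {n : ℕ} (f : Surf n) (i j : Color) (c : Set (Fin n)) : ℕ → Surf n
  | 0 => f
  | m + 1 => shear (shearPow f i j c m) i j c

/-- The unordered pair `{i,j}` is `{R,G}` or `{G,B}`. -/
def GoodPair (i j : Color) : Prop :=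
  ({i, j} : Set Color) = {Color.R, Color.G} ∨ ({i, j} : Set Color) = {Color.G, Color.B}

/-- `A` (together with its complement) witnesses that `f` is Abelian. -/
def IsAbelianWitness (n : ℕ) (f : Surf n) (A : Set (Fin n)) : Prop :=
  A.Nonempty ∧ Aᶜ.Nonempty ∧ ∀ X : Color, (⇑(f X)) '' A = Aᶜ

/-- `f` is Abelian. -/
def IsAbelian (n : ℕ) (f : Surf n) : Prop :=
  ∃ A : Set (Fin n), IsAbelianWitness n f A

/-- `f` is path-like: `f G` and `f B` alone generate a transitive subgroup and have
exactly two fixed points in total. -/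
def IsPathLike (n : ℕ) (f : Surf n) : Prop :=
  (∀ x y : Fin n,
      ∃ p ∈ Subgroup.closure ({f Color.G, f Color.B} : Set (Equiv.Perm (Fin n))),
        p x = y) ∧
    fixedCount (f Color.G) + fixedCount (f Color.B) = 2

/-- `f` and `f'` are isomorphic square-tiled surfaces. -/
def Isomorphic (n : ℕ) (f f' : Surf n) : Prop :=
  ∃ σ : Equiv.Perm (Fin n), ∀ X, f' X = σ * f X * σ⁻¹

/-- One power of a cylinder shear. -/
def ShearPowStep (n : ℕ) (f f' : Surf n) : Prop :=
  ∃ (i j : Color) (c : Set (Fin n)) (m : ℕ),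
    GoodPair i j ∧ IsComponent n f i j c ∧ 1 ≤ m ∧ f' = shearPow f i j c m

/-- A sequence of `L` powers of cylinder shears from `f` to `f'`. -/
def ShearPowSeq (n : ℕ) : ℕ → Surf n → Surf n → Prop
  | 0, f, f' => f = f'
  | L + 1, f, f' => ∃ g, ShearPowStep n f g ∧ ShearPowSeq n L g f'

/-- A single vertical (i.e. `{R,G}`) cylinder shear. -/
def VertStep (n : ℕ) (f f' : Surf n) : Prop :=
  ∃ (i j : Color) (c : Set (Fin n)),
    ({i, j} : Set Color) = {Color.R, Color.G} ∧ IsComponent n f i j c ∧ f' = shear f i j c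

/-- A power of a horizontal (i.e. `{G,B}`) cylinder shear. -/
def HorizPowStep (n : ℕ) (f f' : Surf n) : Prop :=
  ∃ (i j : Color) (c : Set (Fin n)) (m : ℕ),
    ({i, j} : Set Color) = {Color.G, Color.B} ∧ IsComponent n f i j c ∧ 1 ≤ m ∧
      f' = shearPow f i j c m

/-- A sequence of `L` operations, each a single vertical shear or a power of a
horizontal shear. -/
def MixedSeq (n : ℕ) : ℕ → Surf n → Surf n → Prop
  | 0, f, f' => f = f'
  | L + 1, f, f' => ∃ g, (VertStep n f g ∨ HorizPowStep n f g) ∧ MixedSeq n L g f'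

/-- Profile `([2^{μ2}, 4g-2], 0)` (as far as the partition is concerned;
`totalFixed = 0` gives `k = 0`). -/
def ProfileA (n g μ2 : ℕ) (f : Surf n) : Prop :=
  totalFixed f = 0 ∧ cycleCount (prodRGB f) 2 = μ2 ∧
    cycleCount (prodRGB f) (4 * g - 2) = 1 ∧
    ∀ i, 1 ≤ i → i ≠ 2 → i ≠ 4 * g - 2 → cycleCount (prodRGB f) i = 0

/-- Profile `([2^{μ2}, (2g)^2], 0)`. -/
def ProfileB (n g μ2 : ℕ) (f : Surf n) : Prop :=
  totalFixed f = 0 ∧ cycleCount (prodRGB f) 2 = μ2 ∧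
    cycleCount (prodRGB f) (2 * g) = 2 ∧
    ∀ i, 1 ≤ i → i ≠ 2 → i ≠ 2 * g → cycleCount (prodRGB f) i = 0

/-- `α` is an automorphism of `f`. -/
def IsAut {n : ℕ} (f : Surf n) (α : Equiv.Perm (Fin n)) : Prop :=
  ∀ X, α * f X = f X * α

/-- `q` is (a presentation of) the quotient of `f` by the order-2 automorphism `α`:
there is a surjection `p` whose fibers are exactly the `⟨α⟩`-orbits and which
intertwines the permutations. -/
def IsQuotientBy (n m : ℕ) (f : Surf n) (α : Equiv.Perm (Fin n)) (q : Surf m) : Prop :=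
  ∃ p : Fin n → Fin m, Function.Surjective p ∧
    (∀ x y : Fin n, p x = p y ↔ (y = x ∨ y = α x)) ∧
    ∀ X x, p (f X x) = q X (p x)

/-- `4g - 4` where `g` is the genus of `f`, i.e. `Σ_i μ_i (i-2) - k`. -/
noncomputable def genusFour {n : ℕ} (f : Surf n) : ℤ :=
  (∑ i ∈ Finset.Icc 1 n, (cycleCount (prodRGB f) i : ℤ) * ((i : ℤ) - 2)) - (totalFixed f : ℤ)

/-- `α` is a hyperelliptic involution of `f`: an order-2 automorphism whose quotient
is a square-tiled surface of genus 0. -/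
def IsHyperInvolution {n : ℕ} (f : Surf n) (α : Equiv.Perm (Fin n)) : Prop :=
  IsAut f α ∧ α * α = 1 ∧ α ≠ 1 ∧
    ∃ (m : ℕ) (q : Surf m), IsSTS m q ∧ IsQuotientBy n m f α q ∧ genusFour q = -4

/-- `α` sends every point lying on a cycle of length `2g` of `τ_R·τ_G·τ_B` to a
different cycle (hence exchanges the two cycles of length `2g`). -/
def ExchangesTwoCycles {n : ℕ} (f : Surf n) (α : Equiv.Perm (Fin n)) (g : ℕ) : Prop :=
  ∀ x : Fin n, ((prodRGB f).cycleOf x).support.card = 2 * g →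
    ¬ (prodRGB f).SameCycle x (α x)

/-- Membership in `ST^hyp_Ab([2^{μ2}, 4g-2])`. -/
def InSTHypA (n g μ2 : ℕ) (f : Surf n) : Prop :=
  IsSTS n f ∧ IsAbelian n f ∧ ProfileA n g μ2 f ∧ ∃ α, IsHyperInvolution f α

/-- Membership in `ST^hyp_Ab([2^{μ2}, (2g)^2])`. -/
def InSTHypB (n g μ2 : ℕ) (f : Surf n) : Prop :=
  IsSTS n f ∧ IsAbelian n f ∧ ProfileB n g μ2 f ∧
    ∃ α, IsHyperInvolution f α ∧ ExchangesTwoCycles f α g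

theorem restrictPerm_apply_of_mem {α : Type*} {σ : Equiv.Perm α} {c : Set α}
    (h : ∀ x, σ x ∈ c ↔ x ∈ c) {x : α} (hx : x ∈ c) : restrictPerm σ c x = σ x := by
  simp [restrictPerm, h, hx]

theorem restrictPerm_apply_of_notMem {α : Type*} (σ : Equiv.Perm α) {c : Set α}
    {x : α} (hx : x ∉ c) : restrictPerm σ c x = x := by
  unfold restrictPerm
  split_ifs <;> simp [hx]

/-- A set invariant under all generators contains the orbits of its points. -/
theorem orbit_closure_subset {α : Type*} {S : Set (Equiv.Perm α)} {D : Set α}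
    (h : ∀ σ ∈ S, ∀ x, σ x ∈ D ↔ x ∈ D) {x : α} (hx : x ∈ D) :
    MulAction.orbit (Subgroup.closure S) x ⊆ D := by
  have key : ∀ p ∈ Subgroup.closure S, ∀ y, p y ∈ D ↔ y ∈ D := by
    intro p hp
    induction hp using Subgroup.closure_induction with
    | mem p hp => exact h p hp
    | one => simp
    | mul p q _ _ hp hq => intro y; rw [Equiv.Perm.mul_apply, hp, hq]
    | inv p _ hp => intro y; rw [← hp, ← Equiv.Perm.mul_apply, mul_inv_cancel, Equiv.Perm.one_apply]
  rintro _ ⟨⟨p, hp⟩, rfl⟩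
  exact (key p hp x).mpr hx

/-- An orbit of a generated subgroup is invariant under each generator. -/
theorem apply_mem_orbit_closure_iff {α : Type*} {S : Set (Equiv.Perm α)} {σ : Equiv.Perm α}
    (hσ : σ ∈ S) (x y : α) :
    σ y ∈ MulAction.orbit (Subgroup.closure S) x ↔
      y ∈ MulAction.orbit (Subgroup.closure S) x := by
  simp only [← MulAction.orbit_eq_iff]
  exact (MulAction.orbit_smul (⟨σ, Subgroup.subset_closure hσ⟩ : Subgroup.closure S) y).congr_left

section Shear

variable {n : ℕ} {f : Surf n} {i j : Color} {c : Set (Fin n)}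

theorem shear_apply_of_notMem (X : Color) {x : Fin n} (hx : x ∉ c) :
    shear f i j c X x = f X x := by
  unfold shear
  split_ifs <;> simp [restrictPerm_apply_of_notMem _ hx]

theorem shear_apply_of_ne {X : Color} (hi : X ≠ i) (hj : X ≠ j) :
    shear f i j c X = f X := by
  simp [shear, hi, hj]

theorem shear_apply_of_mem (hi : ∀ x, f i x ∈ c ↔ x ∈ c) (hj : ∀ x, f j x ∈ c ↔ x ∈ c)
    {X : Color} (hX : X = i ∨ X = j) {x : Fin n} (hx : x ∈ c) :
    shear f i j c X x = f X (f i (f j x)) := by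
  simp [shear, hX, restrictPerm_apply_of_mem hj hx,
    restrictPerm_apply_of_mem hi ((hj x).mpr hx)]

theorem shear_apply_mem_iff (hi : ∀ x, f i x ∈ c ↔ x ∈ c) (hj : ∀ x, f j x ∈ c ↔ x ∈ c)
    {X : Color} (hX : X = i ∨ X = j) (x : Fin n) :
    shear f i j c X x ∈ c ↔ x ∈ c := by
  have hfX : ∀ x, f X x ∈ c ↔ x ∈ c := by rcases hX with rfl | rfl <;> assumption
  by_cases hx : x ∈ c
  · rw [shear_apply_of_mem hi hj hX hx, hfX, hi, hj]
  · rw [shear_apply_of_notMem X hx, hfX]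

/-- The shears in opposite directions along an invariant set cancel. -/
theorem shear_shear (hf : ∀ X x, f X (f X x) = x)
    (hi : ∀ x, f i x ∈ c ↔ x ∈ c) (hj : ∀ x, f j x ∈ c ↔ x ∈ c) :
    shear (shear f i j c) j i c = f := by
  ext1 X
  by_cases hX : X = i ∨ X = j
  · ext1 x
    by_cases hx : x ∈ c
    · have hi' := shear_apply_mem_iff hi hj (Or.inl rfl)
      have hj' := shear_apply_mem_iff hi hj (Or.inr rfl)
      rw [shear_apply_of_mem hj' hi' hX.symm hx,
        shear_apply_of_mem hi hj hX ((hj' _).mpr ((hi' x).mpr hx)),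
        shear_apply_of_mem hi hj (Or.inr rfl) ((hi' x).mpr hx),
        shear_apply_of_mem hi hj (Or.inl rfl) hx]
      simp only [hf]
    · rw [shear_apply_of_notMem X hx, shear_apply_of_notMem X hx]
  · rw [not_or] at hX
    rw [shear_apply_of_ne hX.2 hX.1, shear_apply_of_ne hX.1 hX.2]

theorem IsComponent.apply_mem_iff (hc : IsComponent n f i j c) {X : Color}
    (hX : X = i ∨ X = j) (x : Fin n) : f X x ∈ c ↔ x ∈ c := by
  obtain ⟨x₀, rfl⟩ := hc
  exact apply_mem_orbit_closure_iff (by rcases hX with rfl | rfl <;> simp) x₀ x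

theorem IsComponent.shear (hf : ∀ X x, f X (f X x) = x) (hc : IsComponent n f i j c) :
    IsComponent n (shear f i j c) i j c := by
  have hi := hc.apply_mem_iff (Or.inl rfl)
  have hj := hc.apply_mem_iff (Or.inr rfl)
  obtain ⟨x₀, hx₀⟩ := hc
  have hx₀c : x₀ ∈ c := hx₀ ▸ MulAction.mem_orbit_self x₀
  refine ⟨x₀, Set.Subset.antisymm ?_ (orbit_closure_subset ?_ hx₀c)⟩
  · set O := MulAction.orbit
      (Subgroup.closure ({_root_.shear f i j c i, _root_.shear f i j c j} :
        Set (Equiv.Perm (Fin n)))) x₀ with hO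
    have hOi : ∀ y, _root_.shear f i j c i y ∈ O ↔ y ∈ O :=
      apply_mem_orbit_closure_iff (by simp) x₀
    have hOj : ∀ y, _root_.shear f i j c j y ∈ O ↔ y ∈ O :=
      apply_mem_orbit_closure_iff (by simp) x₀
    have hcj : ∀ y ∈ c, _root_.shear f i j c i y = f j y := fun y hy => by
      rw [shear_apply_of_mem hi hj (Or.inl rfl) hy, hf]
    have hDj : ∀ y ∈ O ∩ c, f j y ∈ O ∩ c := fun y hy =>
      ⟨hcj y hy.2 ▸ (hOi y).mpr hy.1, (hj y).mpr hy.2⟩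
    have hDi : ∀ y ∈ O ∩ c, f i y ∈ O ∩ c := fun y hy => by
      have h := (hOj _).mpr (hDj y hy).1
      rw [shear_apply_of_mem hi hj (Or.inr rfl) (hDj y hy).2, hf] at h
      have h' := hDj _ ⟨h, (hj _).mpr ((hi y).mpr hy.2)⟩
      rwa [hf] at h'
    calc c = _ := hx₀
      _ ⊆ O ∩ c := orbit_closure_subset (D := O ∩ c) (by
          rintro σ (rfl | rfl) y
          · exact ⟨fun h => hf i y ▸ hDi _ h, hDi y⟩
          · exact ⟨fun h => hf j y ▸ hDj _ h, hDj y⟩)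
          ⟨MulAction.mem_orbit_self x₀, hx₀c⟩
      _ ⊆ O := Set.inter_subset_left
  · rintro σ (rfl | rfl)
    · exact shear_apply_mem_iff hi hj (Or.inl rfl)
    · exact shear_apply_mem_iff hi hj (Or.inr rfl)

end Shear

/-- `c` is still an `{i,j}`-component after the shear `Shear_{c,i,j}`, and
`Shear_{c,j,i}` is inverse to `Shear_{c,i,j}`. -/
theorem stmt4 (n : ℕ) (τ : Surf n) (hτ : IsSTS n τ) (i j : Color) (hij : GoodPair i j)
    (c : Set (Fin n)) (hc : IsComponent n τ i j c) :
    IsComponent n (shear τ i j c) i j c ∧ shear (shear τ i j c) j i c = τ := by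
  have hf : ∀ X x, τ X (τ X x) = x := fun X x => by
    rw [← Equiv.Perm.mul_apply, hτ.2.1, Equiv.Perm.one_apply]
  exact ⟨hc.shear hf,
    shear_shear hf (hc.apply_mem_iff (Or.inl rfl)) (hc.apply_mem_iff (Or.inr rfl))⟩
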